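/- Let ψ : D ⥤ C be a functor of small categories and F : C ⥤ sSet a functor. The commutative square of simplicial sets whose top map r_D^*(F ∘ ψ) → r_C^*F sends an n-simplex (α, x) (with α : [n] ⥤ D) to (ψ ∘ α, x), whose vertical maps are the projections to the nerves, and whose bottom map is Nψ : ND → NC, is a pullback square in the category of simplicial sets. Equivalently, there is a canonical natural isomorphism r_D^* ∘ (ψ^*) ≅ (Nψ)^* ∘ r_C^*, where ψ^* is precomposition with ψ and (Nψ)^* is pullback along Nψ. -/

import Mathlib

open CategoryTheory Simplicial Opposite

universe u

namespace Paper

/-- The last vertex of `u : [k] ⟶ [n]`, i.e. `u(k)`. -/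
def lastV {k n : SimplexCategory} (u : k ⟶ n) : Fin (n.len + 1) :=
  u.toOrderHom (Fin.last k.len)

variable {C : Type u} [SmallCategory C]

/-- An `n`-simplex of the relative nerve `r_C^* F`: a pair `(α, x)` of an `n`-simplex
`α` of the nerve of `C` and a compatible family `x` indexed by all maps `u : [k] ⟶ [n]`,
such that for every factorisation `u = v ≫ u'` the two induced restrictions agree. -/
@[ext]
structure RNSimplex (F : C ⥤ SSet.{u}) (n : SimplexCategory) : Type u where
  α : ComposableArrows C n.len
  x : ∀ (k : SimplexCategory) (u : k ⟶ n), (F.obj (α.obj (lastV u))).obj (op k)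
  compat : ∀ (k k' : SimplexCategory) (v : k ⟶ k') (u' : k' ⟶ n),
    (F.map (α.map (homOfLE (u'.toOrderHom.monotone (Fin.le_last _))))).app (op k)
        (x k (v ≫ u'))
      = (F.obj (α.obj (lastV u'))).map v.op (x k' u')

lemma RNSimplex.ext' {F : C ⥤ SSet.{u}} {n : SimplexCategory} {s t : RNSimplex F n}
    (hα : s.α = t.α) (hx : ∀ (k : SimplexCategory) (u : k ⟶ n), HEq (s.x k u) (t.x k u)) :
    s = t := by
  obtain ⟨α, x, hc⟩ := s
  obtain ⟨α', x', hc'⟩ := t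
  obtain rfl : α = α' := hα
  simp only [mk.injEq, heq_eq_eq, true_and]
  funext k u
  exact eq_of_heq (hx k u)

/-- The relative nerve (rectification) `r_C^* F` of a diagram `F : C ⥤ sSet`. -/
def RelNerve (F : C ⥤ SSet.{u}) : SSet.{u} where
  obj n := RNSimplex F n.unop
  map {n n'} w := ↾fun s =>
    { α := s.α.whiskerLeft (SimplexCategory.toCat.map w.unop).toFunctor
      x := fun k u => s.x k (u ≫ w.unop)
      compat := fun k k' v u' => s.compat k k' v (u' ≫ w.unop) }
  map_id n := by
    refine ConcreteCategory.hom_ext _ _ fun s => ?_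
    refine RNSimplex.ext' ?_ ?_
    · show s.α.whiskerLeft (SimplexCategory.toCat.map (𝟙 n.unop)).toFunctor = s.α
      rw [CategoryTheory.Functor.map_id]
      rfl
    · intro k u
      show HEq (s.x k (u ≫ 𝟙 n.unop)) (s.x k u)
      rw [Category.comp_id]
  map_comp {n n' n''} w w' := by
    refine ConcreteCategory.hom_ext _ _ fun s => ?_
    refine RNSimplex.ext' ?_ ?_
    · show s.α.whiskerLeft (SimplexCategory.toCat.map (w ≫ w').unop).toFunctor
        = (s.α.whiskerLeft (SimplexCategory.toCat.map w.unop).toFunctor).whiskerLeft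
            (SimplexCategory.toCat.map w'.unop).toFunctor
      rw [unop_comp, CategoryTheory.Functor.map_comp]
      rfl
    · intro k u
      show HEq (s.x k (u ≫ (w ≫ w').unop)) (s.x k ((u ≫ w'.unop) ≫ w.unop))
      rw [unop_comp, Category.assoc]

/-- The canonical projection `r_C^* F ⟶ N C`. -/
def relNerveProj (F : C ⥤ SSet.{u}) : RelNerve F ⟶ nerve C where
  app _ := ↾fun s => s.α
  naturality _ _ _ := rfl

end Paper

namespace Paper

variable {C : Type u} [SmallCategory C]

/-- The map `r_C^*(f) : r_C^* F ⟶ r_C^* G` induced by a natural transformation `f : F ⟶ G`,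
given by `(α, x) ↦ (α, (f(x_u))_u)`. -/
def relNerveMap {F G : C ⥤ SSet.{u}} (f : F ⟶ G) : RelNerve F ⟶ RelNerve G where
  app n := ↾fun s =>
    { α := s.α
      x := fun k u => (f.app (s.α.obj (lastV u))).app (op k) (s.x k u)
      compat := by
        intro k k' v u'
        have h₁ := (ConcreteCategory.congr_hom (NatTrans.congr_app
          (f.naturality (s.α.map (homOfLE (u'.toOrderHom.monotone (Fin.le_last _)))))
          (op k)) (s.x k (v ≫ u'))).symm
        have h₂ := congrArg (fun y => (f.app (s.α.obj (lastV u'))).app (op k) y)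
          (s.compat k k' v u')
        have h₃ := NatTrans.naturality_apply (f.app (s.α.obj (lastV u'))) v.op (s.x k' u')
        exact Eq.trans h₁ (Eq.trans h₂ h₃) }
  naturality n n' w := rfl

/-- The relative nerve as a functor `Fun(C, sSet) ⥤ sSet/N C`. -/
def relNerveFunctor (C : Type u) [SmallCategory C] :
    (C ⥤ SSet.{u}) ⥤ Over (nerve C) where
  obj F := Over.mk (relNerveProj F)
  map f := Over.homMk (relNerveMap f) rfl

end Paper

namespace Paper

variable {C : Type u} [SmallCategory C]

/-- The nerve of a functor `ψ : D ⥤ C`, i.e. the induced map `N ψ : N D ⟶ N C`. -/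
def nerveMapF {D : Type u} [SmallCategory D] (ψ : D ⥤ C) : nerve D ⟶ nerve C where
  app _ := ↾fun α => α ⋙ ψ
  naturality _ _ _ := rfl

/-- The change-of-index comparison map `r_D^*(ψ^* F) ⟶ r_C^* F`, sending `(α, x)` to
`(ψ ∘ α, x)`. -/
def relNerveComparison {D : Type u} [SmallCategory D] (ψ : D ⥤ C) (F : C ⥤ SSet.{u}) :
    RelNerve (ψ ⋙ F) ⟶ RelNerve F where
  app n := ↾fun s =>
    { α := s.α ⋙ ψ
      x := fun k u => s.x k u
      compat := fun k k' v u' => s.compat k k' v u' }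
  naturality _ _ _ := rfl

end Paper

namespace Paper

/-- **Statement 7.** For a functor `ψ : D ⥤ C` of small categories and `F : C ⥤ sSet`, the
square with top map `r_D^*(ψ^* F) ⟶ r_C^* F`, `(α, x) ↦ (ψ ∘ α, x)`, vertical maps the
projections to the nerves, and bottom map `N ψ : N D ⟶ N C`, is a pullback square of
simplicial sets. -/
theorem relNerve_change_of_index_isPullback {C D : Type u} [SmallCategory C]
    [SmallCategory D] (ψ : D ⥤ C) (F : C ⥤ SSet.{u}) :
    IsPullback (relNerveComparison ψ F) (relNerveProj (ψ ⋙ F)) (relNerveProj F)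
      (nerveMapF ψ) := by
  refine IsPullback.of_forall_isPullback_app fun n => ?_
  rw [Limits.Types.isPullback_iff]
  refine ⟨rfl, ?_, ?_⟩
  · rintro ⟨α, x, hx⟩ ⟨β, y, hy⟩ ⟨h₁, h₂⟩
    obtain rfl : α = β := h₂
    obtain rfl : x = y := eq_of_heq (RNSimplex.mk.inj h₁).2
    rfl
  · rintro ⟨α, x, hx⟩ β h
    obtain rfl : α = β ⋙ ψ := h
    exact ⟨(⟨β, x, hx⟩ : RNSimplex (ψ ⋙ F) n.unop), rfl, rfl⟩

end Paper
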